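/- (Sherman's relation.) Let 𝐈 ∈ Subsets(r,n,s) with 1 ≤ kdim 𝐈 ≤ r−1, and set 𝐉 := kPos(𝐈) ∈ Subsets(kdim 𝐈, r, s). Then 0 ≤ tdim 𝐈 − edim 𝐈 ≤ tdim(𝐈^𝐉) − edim(𝐈^𝐉). -/

import Mathlib

open Module

noncomputable section

/-- A complete flag on `ℂ^m`: an increasing family of subspaces with
`dim (F i) = i + 1` (`0`-based indexing, so `F i` is the `i+1`-st step). -/
structure Flagg (m : ℕ) where
  F : Fin m → Submodule ℂ (Fin m → ℂ)
  mono : Monotone F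
  rank_eq : ∀ i : Fin m, finrank ℂ (F i) = (i : ℕ) + 1

/-- An `s`-tuple `J` of (strictly increasing) maps `[d] → [r]` is *intersecting* if
for every `s`-tuple of complete flags on `ℂ^r` the corresponding intersection of
Schubert varieties in the Grassmannian `Gr(d, ℂ^r)` is nonempty. -/
def Intersecting {s d r : ℕ} (J : Fin s → Fin d → Fin r) : Prop :=
  ∀ F : Fin s → Flagg r, ∃ V : Submodule ℂ (Fin r → ℂ), finrank ℂ V = d ∧
    ∀ (l : Fin s) (k : Fin d), (k : ℕ) + 1 ≤ finrank ℂ ↥(V ⊓ (F l).F (J l k))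

/-- `dim I = ∑_j (I(j) - j)`. -/
def dimI {d r : ℕ} (J : Fin d → Fin r) : ℤ := ∑ k, ((J k : ℤ) - (k : ℤ))

/-- Expected dimension of a tuple `J ∈ Subsets(d,r,s)`. -/
def edim {s d r : ℕ} (J : Fin s → Fin d → Fin r) : ℤ :=
  (d : ℤ) * ((r : ℤ) - (d : ℤ)) - ∑ l, ((d : ℤ) * ((r : ℤ) - (d : ℤ)) - dimI (J l))

/-- `dim` for raw `ℕ`-valued increasing sequences. -/
def dimN {d : ℕ} (f : Fin d → ℕ) : ℤ := ∑ k, ((f k : ℤ) - (k : ℤ))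

/-- Expected dimension for raw `ℕ`-valued tuples, with ambient dimension `n` explicit. -/
def edimN {s d : ℕ} (n : ℕ) (f : Fin s → Fin d → ℕ) : ℤ :=
  (d : ℤ) * ((n : ℤ) - (d : ℤ)) - ∑ l, ((d : ℤ) * ((n : ℤ) - (d : ℤ)) - dimN (f l))

/-- `T(Λ) = ∑_l ∑_j Λ_l(j)`. -/
def TT {s r : ℕ} (Λ : Fin s → Fin r → ℝ) : ℝ := ∑ l, ∑ j, Λ l j

/-- `T_J(Λ) = ∑_l ∑_{j ∈ J_l} Λ_l(j)`. -/
def TJ {s d r : ℕ} (J : Fin s → Fin d → Fin r) (Λ : Fin s → Fin r → ℝ) : ℝ :=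
  ∑ l, ∑ k, Λ l (J l k)

/-- `Γ(J)_l(k) = k - J_l(k) + (r - d)`, a weakly decreasing real `d`-tuple. -/
def GammaT {s d r : ℕ} (J : Fin s → Fin d → Fin r) : Fin s → Fin d → ℝ :=
  fun l k => (k : ℝ) - (J l k : ℝ) + ((r : ℝ) - (d : ℝ))

/-- Membership of `(Λ, t)` in the Kirwan cone `𝒦(r,s)`: each `Λ_l` is weakly
decreasing and there are Hermitian matrices `A_1, …, A_s` summing to `t·I_r`
whose decreasingly-ordered spectra are the `Λ_l`. -/
def KirwanMem {s r : ℕ} (Λ : Fin s → Fin r → ℝ) (t : ℝ) : Prop :=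
  (∀ l, Antitone (Λ l)) ∧
  ∃ (A : Fin s → Matrix (Fin r) (Fin r) ℂ) (hA : ∀ l, (A l).IsHermitian),
    (∑ l, A l) = (t : ℂ) • (1 : Matrix (Fin r) (Fin r) ℂ) ∧
    ∀ l, ∃ e : Equiv.Perm (Fin r), ∀ i, Λ l i = (hA l).eigenvalues (e i)

/-- The subspace of a flag with `k` elements (so `flagAt G 0 = ⊥`). -/
def flagAt {m : ℕ} (G : Flagg m) : ℕ → Submodule ℂ (Fin m → ℂ)
  | 0 => ⊥
  | (k + 1) => if h : k < m then G.F ⟨k, h⟩ else ⊤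

/-- The space `ℒ_I(F,G)` of linear maps `φ : ℂ^r → ℂ^q` with
`φ(F_l(j)) ⊆ G_l(I_l(j) - j)` for all `l, j`. -/
def LSpace {s r q : ℕ} (I : Fin s → Fin r → ℕ) (F : Fin s → Flagg r) (G : Fin s → Flagg q) :
    Submodule ℂ ((Fin r → ℂ) →ₗ[ℂ] (Fin q → ℂ)) where
  carrier := {φ | ∀ (l : Fin s) (j : Fin r), ∀ v ∈ (F l).F j,
    φ v ∈ flagAt (G l) (I l j - (j : ℕ))}
  add_mem' := by
    intro a b ha hb l j v hv
    simpa using add_mem (ha l j v hv) (hb l j v hv)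
  zero_mem' := by
    intro l j v hv
    simp
  smul_mem' := by
    intro c a ha l j v hv
    simpa using Submodule.smul_mem _ c (ha l j v hv)

/-- The true dimension `tdim I`, for a raw tuple `I ∈ Subsets(r, r + q, s)`
(here `q = n - r`). -/
def tdim {s : ℕ} (r q : ℕ) (I : Fin s → Fin r → ℕ) : ℕ :=
  sInf {m : ℕ | ∃ (F : Fin s → Flagg r) (G : Fin s → Flagg q), finrank ℂ (LSpace I F G) = m}

/-- The kernel dimension `kdim I`. -/
def kdim {s : ℕ} (r q : ℕ) (I : Fin s → Fin r → ℕ) : ℕ :=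
  sInf {m : ℕ | ∃ (F : Fin s → Flagg r) (G : Fin s → Flagg q)
      (φ : (Fin r → ℂ) →ₗ[ℂ] (Fin q → ℂ)), φ ∈ LSpace I F G ∧
      finrank ℂ (LSpace I F G) = tdim r q I ∧ finrank ℂ (LinearMap.ker φ) = m}

/-- The (`0`-based) Schubert position of a subspace `W` w.r.t. a flag:
`posN Fl W k` is the least `j` with `dim (Fl(j) ⊓ W) = k + 1`. -/
def posN {m : ℕ} (Fl : Flagg m) (W : Submodule ℂ (Fin m → ℂ)) (k : ℕ) : ℕ :=
  sInf {j : ℕ | ∃ h : j < m, finrank ℂ ↥(Fl.F ⟨j, h⟩ ⊓ W) = k + 1}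

/-- The (`0`-based, `ℕ`-valued) kernel position `kPos(I)_l(k)`. -/
def kPosFun {s : ℕ} (r q : ℕ) (I : Fin s → Fin r → ℕ) (l : Fin s) (k : ℕ) : ℕ :=
  sInf {p : ℕ | ∃ (F : Fin s → Flagg r) (G : Fin s → Flagg q)
      (φ : (Fin r → ℂ) →ₗ[ℂ] (Fin q → ℂ)), φ ∈ LSpace I F G ∧
      finrank ℂ (LSpace I F G) = tdim r q I ∧
      finrank ℂ (LinearMap.ker φ) = kdim r q I ∧ posN (F l) (LinearMap.ker φ) k = p}

/-- Apply an `r`-tuple of reals at a natural index (junk value `0` out of range). -/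
def applyI {r : ℕ} (f : Fin r → ℝ) (j : ℕ) : ℝ := if h : j < r then f ⟨j, h⟩ else 0

/-- Apply an `r`-tuple of naturals at a natural index (junk value `0` out of range). -/
def applyN {r : ℕ} (f : Fin r → ℕ) (j : ℕ) : ℕ := if h : j < r then f ⟨j, h⟩ else 0

/-- The slope `slope_θ(J) = (1/d) ∑_l ∑_{j ∈ J_l} θ_l(j)` of a tuple. -/
def slopeT {s d r : ℕ} (θ : Fin s → Fin r → ℝ) (J : Fin s → Fin d → Fin r) : ℝ :=
  ((d : ℝ))⁻¹ * ∑ l, ∑ k, θ l (J l k)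

/-- The slope `slope_θ(W, F) = slope_θ(Pos(W, F))` of a (nonzero) subspace. -/
def slopeW {s r : ℕ} (θ : Fin s → Fin r → ℝ) (F : Fin s → Flagg r)
    (W : Submodule ℂ (Fin r → ℂ)) : ℝ :=
  ((finrank ℂ W : ℝ))⁻¹ * ∑ l, ∑ k ∈ Finset.range (finrank ℂ W), applyI (θ l) (posN (F l) W k)

end
/-- The raw (`ℕ`-valued) version of a tuple `𝐈 ∈ Subsets(r,n,s)`. -/
def Iraw {s r n : ℕ} (I : Fin s → Fin r → Fin n) : Fin s → Fin r → ℕ :=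
  fun l j => (I l j : ℕ)

/-- `kdim 𝐈` for `𝐈 ∈ Subsets(r,n,s)`. -/
noncomputable def kdimI {s r n : ℕ} (I : Fin s → Fin r → Fin n) : ℕ :=
  kdim r (n - r) (Iraw I)

/-- The raw tuple `𝐈^𝐉 ∈ Subsets(kdim 𝐈, n-r+kdim 𝐈, s)` for `𝐉 = kPos(𝐈)`:
`𝐈^𝐉(k) = 𝐈(𝐉(k)) - 𝐉(k) + k`. -/
noncomputable def expKPos {s r n : ℕ} (I : Fin s → Fin r → Fin n) :
    Fin s → Fin (kdimI I) → ℕ :=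
  fun l k => applyN (Iraw I l) (kPosFun r (n - r) (Iraw I) l (k : ℕ))
    - kPosFun r (n - r) (Iraw I) l (k : ℕ) + (k : ℕ)


/-! ### Linear pencils -/

section Pencil

open Filter Topology

theorem sh_rank_factor {E E' : Type*} [AddCommGroup E] [Module ℂ E] [AddCommGroup E'] [Module ℂ E']
    [FiniteDimensional ℂ E] (f : E →ₗ[ℂ] E') (m : ℕ) (hm : finrank ℂ (LinearMap.range f) = m) :
    ∃ (i : (Fin m → ℂ) →ₗ[ℂ] E)
      (p : E' →ₗ[ℂ] (Fin m → ℂ)), p ∘ₗ f ∘ₗ i = LinearMap.id := by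
  let e : LinearMap.range f ≃ₗ[ℂ] (Fin m → ℂ) :=
    LinearEquiv.ofFinrankEq _ _ (by simp [hm])
  obtain ⟨i, hi⟩ := LinearMap.exists_rightInverse_of_surjective (e.toLinearMap ∘ₗ f.rangeRestrict)
    (LinearMap.range_eq_top.2 (e.surjective.comp f.surjective_rangeRestrict))
  obtain ⟨p, hp⟩ := LinearMap.exists_extend e.toLinearMap
  refine ⟨i, p, ?_⟩
  rw [← hi, ← hp]
  rfl

theorem sh_rank_of_det {E E' : Type*} [AddCommGroup E] [Module ℂ E] [AddCommGroup E'] [Module ℂ E']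
    [FiniteDimensional ℂ E] (f : E →ₗ[ℂ] E') (m : ℕ) (i : (Fin m → ℂ) →ₗ[ℂ] E)
    (p : E' →ₗ[ℂ] (Fin m → ℂ)) (h : (LinearMap.toMatrix' (p ∘ₗ f ∘ₗ i)).det ≠ 0) :
    m ≤ finrank ℂ (LinearMap.range f) := by
  have h1 : IsUnit (LinearMap.det (p ∘ₗ f ∘ₗ i)) := by
    rw [← LinearMap.det_toMatrix']; exact h.isUnit
  have hinj : Function.Injective (p ∘ₗ f ∘ₗ i) := (LinearEquiv.ofIsUnitDet (f := p ∘ₗ f ∘ₗ i)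
    (v := Pi.basisFun ℂ (Fin m)) (v' := Pi.basisFun ℂ (Fin m))
    (by rw [LinearMap.det_toMatrix]; exact h1)).injective
  have h2 : Function.Injective (f ∘ₗ i) := by
    intro x y hxy
    apply hinj
    simpa using congrArg p hxy
  calc m = finrank ℂ (Fin m → ℂ) := by simp
    _ = finrank ℂ (LinearMap.range (f ∘ₗ i)) := (LinearMap.finrank_range_of_inj h2).symm
    _ ≤ _ := Submodule.finrank_mono (LinearMap.range_comp_le_range i f)

theorem sh_pencil {E E' : Type*} [AddCommGroup E] [Module ℂ E] [AddCommGroup E'] [Module ℂ E']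
    [FiniteDimensional ℂ E] (A B : E →ₗ[ℂ] E') (t₀ : ℂ) :
    ∀ᶠ t in 𝓝[≠] (0 : ℂ), finrank ℂ (LinearMap.range (A + t₀ • B)) ≤
      finrank ℂ (LinearMap.range (A + t • B)) := by
  generalize hm : finrank ℂ (LinearMap.range (A + t₀ • B)) = m
  obtain ⟨i, p, hip⟩ := sh_rank_factor (A + t₀ • B) m hm
  let M0 := LinearMap.toMatrix' (p ∘ₗ A ∘ₗ i)
  let M1 := LinearMap.toMatrix' (p ∘ₗ B ∘ₗ i)
  have key : ∀ t : ℂ, LinearMap.toMatrix' (p ∘ₗ (A + t • B) ∘ₗ i) = M0 + t • M1 := by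
    intro t
    rw [LinearMap.add_comp, LinearMap.comp_add, LinearMap.smul_comp, LinearMap.comp_smul, map_add,
      map_smul]
  let P : Polynomial ℂ := (M0.map Polynomial.C + (Polynomial.X : Polynomial ℂ) • M1.map Polynomial.C).det
  have hP : ∀ t : ℂ, P.eval t = (M0 + t • M1).det := by
    intro t
    have := RingHom.map_det (Polynomial.evalRingHom t)
      (M0.map Polynomial.C + (Polynomial.X : Polynomial ℂ) • M1.map Polynomial.C)
    simp only [Polynomial.coe_evalRingHom] at this
    rw [this]
    congr 1
    ext a b
    simp only [RingHom.mapMatrix_apply, Matrix.map_apply, Matrix.add_apply, Matrix.smul_apply,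
      Polynomial.coe_evalRingHom, Polynomial.eval_add, smul_eq_mul, Polynomial.eval_mul,
      Polynomial.eval_X, Polynomial.eval_C]
  have hne : P ≠ 0 := by
    intro h0
    have := hP t₀
    rw [h0, ← key, hip, Polynomial.eval_zero, LinearMap.toMatrix'_id, Matrix.det_one] at this
    exact zero_ne_one this
  have hfin : {t : ℂ | P.IsRoot t}.Finite := Polynomial.finite_setOfPred_isRoot hne
  have hev : ∀ᶠ t in 𝓝[≠] (0 : ℂ), ¬ P.IsRoot t := by
    have := (hfin.subset (Set.sdiff_subset (t := {(0:ℂ)}))).isClosed.isOpen_compl.mem_nhds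
      (x := (0:ℂ)) (by simp)
    rw [eventually_nhdsWithin_iff]
    filter_upwards [this] with t ht ht0 hroot
    exact ht ⟨hroot, ht0⟩
  filter_upwards [hev] with t ht
  refine sh_rank_of_det _ m i p ?_
  rw [key, ← hP]
  exact ht

theorem sh_pencil_zero {E E' : Type*} [AddCommGroup E] [Module ℂ E] [AddCommGroup E'] [Module ℂ E']
    [FiniteDimensional ℂ E] (A B : E →ₗ[ℂ] E') :
    ∀ᶠ t in 𝓝[≠] (0 : ℂ), finrank ℂ (LinearMap.range A) ≤
      finrank ℂ (LinearMap.range (A + t • B)) := by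
  have := sh_pencil A B 0
  rwa [zero_smul, add_zero] at this

/-- Derivative of a pencil of maximal rank at `0`. -/
theorem sh_pencil_deriv {E E' : Type*} [AddCommGroup E] [Module ℂ E] [AddCommGroup E'] [Module ℂ E']
    [FiniteDimensional ℂ E] [FiniteDimensional ℂ E'] (A B : E →ₗ[ℂ] E')
    (h : ∀ᶠ t in 𝓝[≠] (0 : ℂ), finrank ℂ (LinearMap.range (A + t • B)) ≤
      finrank ℂ (LinearMap.range A)) (x : E) (hx : A x = 0) : B x ∈ LinearMap.range A := by
  by_contra hn
  let C : E × ℂ →ₗ[ℂ] E' := A.coprod (LinearMap.toSpanSingleton ℂ E' (B x))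
  let D : E × ℂ →ₗ[ℂ] E' := B.coprod 0
  have h1 := sh_pencil_zero C D
  have hself : ∀ᶠ t in 𝓝[≠] (0 : ℂ), t ≠ 0 := eventually_mem_nhdsWithin
  obtain ⟨t, ht, ht1, ht0⟩ := (h.and (h1.and hself)).exists
  have hle : LinearMap.range (C + t • D) ≤ LinearMap.range (A + t • B) := by
    rintro _ ⟨⟨e, c⟩, rfl⟩
    refine ⟨e + (c / t) • x, ?_⟩
    simp only [C, D, LinearMap.add_apply, LinearMap.smul_apply, map_add, map_smul, hx,
      LinearMap.coprod_apply, LinearMap.toSpanSingleton_apply, LinearMap.zero_apply, smul_add,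
      smul_zero, smul_smul, add_zero]
    rw [div_mul_cancel₀ _ ht0]
    abel
  have hlt : LinearMap.range A < LinearMap.range C := by
    refine lt_of_le_of_ne ?_ ?_
    · rintro _ ⟨e, rfl⟩
      exact ⟨(e, 0), by simp [C]⟩
    · intro heq
      apply hn
      rw [heq]
      exact ⟨(0, 1), by simp [C]⟩
  have h2 := Submodule.finrank_lt_finrank_of_lt hlt
  have h3 := Submodule.finrank_mono hle
  omega

/-- Deformation of a kernel element along a pencil of maximal rank at `0`. -/
theorem sh_pencil_section {E E' V Q : Type*} [AddCommGroup E] [Module ℂ E] [AddCommGroup E']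
    [Module ℂ E'] [AddCommGroup V] [Module ℂ V] [AddCommGroup Q] [Module ℂ Q]
    [FiniteDimensional ℂ E] [FiniteDimensional ℂ E'] [FiniteDimensional ℂ V]
    (A B : E →ₗ[ℂ] E')
    (h : ∀ᶠ t in 𝓝[≠] (0 : ℂ), finrank ℂ (LinearMap.range (A + t • B)) ≤
      finrank ℂ (LinearMap.range A)) (R : E →ₗ[ℂ] (V →ₗ[ℂ] Q)) (x : E) (hx : A x = 0) :
    ∀ᶠ t in 𝓝[≠] (0 : ℂ), ∃ y, (A + t • B) y = 0 ∧
      finrank ℂ (LinearMap.ker (R y)) ≤ finrank ℂ (LinearMap.ker (R x)) := by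
  -- pseudo-inverse
  generalize hm : finrank ℂ (LinearMap.range A) = m at h
  obtain ⟨i, p, hip⟩ := sh_rank_factor A m hm
  let J : E' →ₗ[ℂ] E := i ∘ₗ p
  have hJAJ : ∀ z, J (A (J z)) = J z := by
    intro z
    have := LinearMap.congr_fun hip (p z)
    simp only [LinearMap.comp_apply, LinearMap.id_apply] at this
    simp [J, this]
  have hi : Function.Injective i := by
    intro a b hab
    have h1 := LinearMap.congr_fun hip a
    have h2 := LinearMap.congr_fun hip b
    simp only [LinearMap.comp_apply, LinearMap.id_apply] at h1 h2
    rw [← h1, ← h2, hab]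
  let bs := Module.finBasis ℂ E
  let M := LinearMap.toMatrix bs bs (J ∘ₗ B)
  let xv := bs.equivFun x
  let yv : ℂ → (Fin (finrank ℂ E) → ℂ) := fun t => (1 + t • M).adjugate.mulVec xv
  let y : ℂ → E := fun t => bs.equivFun.symm (yv t)
  have hyv : Continuous yv := by
    have : Continuous fun t : ℂ => (1 + t • M).adjugate := by
      apply Continuous.matrix_adjugate
      fun_prop
    exact this.matrix_mulVec continuous_const
  have hy0 : y 0 = x := by simp [y, yv, xv]
  have hy : ∀ t, y t + t • J (B (y t)) = (1 + t • M).det • x := by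
    intro t
    apply bs.equivFun.injective
    have h1 : bs.equivFun (J (B (y t))) = M.mulVec (yv t) := by
      have := LinearMap.toMatrix_mulVec_repr bs bs (J ∘ₗ B) (y t)
      simp only [LinearMap.comp_apply] at this
      have e2 : (bs.repr (y t) : Fin (finrank ℂ E) → ℂ) = yv t := by
        have := bs.equivFun.apply_symm_apply (yv t)
        exact this
      rw [e2] at this
      exact this.symm
    rw [map_add, map_smul, map_smul, h1]
    simp only [y, LinearEquiv.apply_symm_apply]
    have h2 : yv t + t • M.mulVec (yv t) = (1 + t • M).mulVec (yv t) := by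
      rw [Matrix.add_mulVec, Matrix.one_mulVec, Matrix.smul_mulVec]
    rw [h2]
    simp only [yv, Matrix.mulVec_mulVec, Matrix.mul_adjugate, Matrix.smul_mulVec, Matrix.one_mulVec]
    rfl
  have hJ : ∀ t, p ((A + t • B) (y t)) = 0 := by
    intro t
    apply hi
    rw [map_zero]
    change J ((A + t • B) (y t)) = 0
    have h1 := congrArg (fun z => J (A z)) (hy t)
    simp only [map_add, map_smul, hJAJ, hx, map_zero, smul_zero] at h1
    simpa using h1
  -- rank of `p ∘ (A + t B)`
  have hr : ∀ᶠ t in 𝓝[≠] (0 : ℂ), m ≤ finrank ℂ (LinearMap.range (p ∘ₗ A + t • (p ∘ₗ B))) := by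
    have h1 := sh_pencil_zero (p ∘ₗ A) (p ∘ₗ B)
    have h2 : m ≤ finrank ℂ (LinearMap.range (p ∘ₗ A)) := by
      refine sh_rank_of_det _ m i LinearMap.id ?_
      rw [LinearMap.id_comp, LinearMap.comp_assoc, hip]
      simp
    filter_upwards [h1] with t ht
    omega
  -- rank of `R (y t)`
  obtain ⟨i', p', hip'⟩ := sh_rank_factor (R x) _ rfl
  have hR : ∀ᶠ t in 𝓝[≠] (0 : ℂ),
      (LinearMap.toMatrix' (p' ∘ₗ R (y t) ∘ₗ i')).det ≠ 0 := by
    let Φ : (Fin (finrank ℂ E) → ℂ) →ₗ[ℂ] Matrix (Fin (finrank ℂ (LinearMap.range (R x))))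
        (Fin (finrank ℂ (LinearMap.range (R x)))) ℂ :=
      { toFun := fun v => LinearMap.toMatrix' (p' ∘ₗ R (bs.equivFun.symm v) ∘ₗ i')
        map_add' := by
          intro a b
          rw [map_add, map_add, LinearMap.add_comp, LinearMap.comp_add, map_add]
        map_smul' := by
          intro c a
          rw [RingHom.id_apply, map_smul, map_smul, LinearMap.smul_comp, LinearMap.comp_smul,
            map_smul] }
    have hc : Continuous fun t => (Φ (yv t)).det :=
      (Φ.continuous_of_finiteDimensional.comp hyv).matrix_det
    have h0 : (Φ (yv 0)).det ≠ 0 := by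
      change (LinearMap.toMatrix' (p' ∘ₗ R (y 0) ∘ₗ i')).det ≠ 0
      rw [hy0, hip']
      simp
    exact (hc.continuousAt.eventually_ne h0).filter_mono nhdsWithin_le_nhds
  filter_upwards [h, hr, hR] with t ht htr htR
  refine ⟨y t, ?_, ?_⟩
  · have e1 : p ∘ₗ A + t • (p ∘ₗ B) = p ∘ₗ (A + t • B) := by
      ext v : 1; simp
    rw [e1] at htr
    have e2 := LinearMap.finrank_range_add_finrank_ker (p ∘ₗ (A + t • B))
    have e3 := LinearMap.finrank_range_add_finrank_ker (A + t • B)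
    have e4 : LinearMap.ker (A + t • B) = LinearMap.ker (p ∘ₗ (A + t • B)) :=
      Submodule.eq_of_le_of_finrank_le (LinearMap.ker_le_ker_comp _ _) (by omega)
    have e5 : y t ∈ LinearMap.ker (A + t • B) := by
      rw [e4]
      exact hJ t
    exact e5
  · have e1 := sh_rank_of_det (R (y t)) _ i' p' htR
    have e2 := LinearMap.finrank_range_add_finrank_ker (R (y t))
    have e3 := LinearMap.finrank_range_add_finrank_ker (R x)
    omega

end Pencil

/-! ### Diagonal plus product of subspaces -/

section Diag

open Filter Topology

/-- The subspace `diag(X) + ∏ H_l` of `X^s`. -/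
def shRR {s : ℕ} {X : Type*} [AddCommGroup X] [Module ℂ X] (H : Fin s → Submodule ℂ X) :
    Submodule ℂ (Fin s → X) :=
  LinearMap.range (LinearMap.pi fun _ : Fin s => (LinearMap.id : X →ₗ[ℂ] X)) ⊔
    Submodule.pi Set.univ H

theorem sh_mem_RR {s : ℕ} {X : Type*} [AddCommGroup X] [Module ℂ X] (H : Fin s → Submodule ℂ X)
    (z : Fin s → X) : z ∈ shRR H ↔ ∃ x : X, ∀ l, z l - x ∈ H l := by
  rw [shRR, Submodule.mem_sup]
  constructor
  · rintro ⟨_, ⟨x, rfl⟩, y, hy, rfl⟩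
    refine ⟨x, fun l => ?_⟩
    simpa using hy l trivial
  · rintro ⟨x, hx⟩
    refine ⟨_, ⟨x, rfl⟩, fun l => z l - x, fun l _ => hx l, ?_⟩
    ext l
    simp

theorem sh_RR_mono {s : ℕ} {X : Type*} [AddCommGroup X] [Module ℂ X] {H H' : Fin s → Submodule ℂ X}
    (h : ∀ l, H l ≤ H' l) : shRR H ≤ shRR H' := by
  intro z hz
  rw [sh_mem_RR] at hz ⊢
  obtain ⟨x, hx⟩ := hz
  exact ⟨x, fun l => h l (hx l)⟩

/-- The parametrization of `shRR` for the translated subspaces `(1 + t T_l) H_l`. -/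
def shA {s : ℕ} {X : Type*} [AddCommGroup X] [Module ℂ X] (H : Fin s → Submodule ℂ X) :
    X × ((l : Fin s) → H l) →ₗ[ℂ] (Fin s → X) :=
  LinearMap.pi fun l => LinearMap.fst _ _ _ -
    (H l).subtype ∘ₗ LinearMap.proj l ∘ₗ LinearMap.snd _ _ _

/-- The derivative of the parametrization. -/
def shB {s : ℕ} {X : Type*} [AddCommGroup X] [Module ℂ X] (H : Fin s → Submodule ℂ X)
    (T : Fin s → X →ₗ[ℂ] X) :
    X × ((l : Fin s) → H l) →ₗ[ℂ] (Fin s → X) :=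
  LinearMap.pi fun l => -
    (T l ∘ₗ (H l).subtype ∘ₗ LinearMap.proj l ∘ₗ LinearMap.snd _ _ _)

theorem sh_AB_apply {s : ℕ} {X : Type*} [AddCommGroup X] [Module ℂ X] (H : Fin s → Submodule ℂ X)
    (T : Fin s → X →ₗ[ℂ] X) (t : ℂ) (z : X × ((l : Fin s) → H l)) (l : Fin s) :
    (shA H + t • shB H T) z l = z.1 - ((LinearMap.id : X →ₗ[ℂ] X) + t • T l) (z.2 l : X) := by
  simp [shA, shB]
  abel

theorem sh_range_AB {s : ℕ} {X : Type*} [AddCommGroup X] [Module ℂ X] (H : Fin s → Submodule ℂ X)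
    (T : Fin s → X →ₗ[ℂ] X) (t : ℂ) :
    LinearMap.range (shA H + t • shB H T) =
      shRR fun l => (H l).map (LinearMap.id + t • T l) := by
  ext z
  rw [sh_mem_RR]
  constructor
  · rintro ⟨w, rfl⟩
    refine ⟨w.1, fun l => ?_⟩
    rw [sh_AB_apply]
    refine ⟨-(w.2 l : X), neg_mem (w.2 l).2, ?_⟩
    rw [map_neg]; abel
  · rintro ⟨x, hx⟩
    choose y hy hyx using hx
    refine ⟨(x, fun l => -⟨y l, hy l⟩), ?_⟩
    ext l
    rw [sh_AB_apply]
    simp only [Submodule.coe_neg, map_neg, hyx]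
    abel

theorem sh_range_A {s : ℕ} {X : Type*} [AddCommGroup X] [Module ℂ X] (H : Fin s → Submodule ℂ X) :
    LinearMap.range (shA H) = shRR H := by
  have := sh_range_AB H 0 0
  rw [zero_smul, add_zero] at this
  simpa using this

theorem sh_euler {s : ℕ} {X : Type*} [AddCommGroup X] [Module ℂ X] [FiniteDimensional ℂ X]
    (H : Fin s → Submodule ℂ X) :
    finrank ℂ (shRR H) + finrank ℂ (⨅ l, H l : Submodule ℂ X) =
      finrank ℂ X + ∑ l, finrank ℂ (H l) := by
  have h1 := LinearMap.finrank_range_add_finrank_ker (shA H)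
  rw [sh_range_A] at h1
  have h2 : finrank ℂ (X × ((l : Fin s) → H l)) = finrank ℂ X + ∑ l, finrank ℂ (H l) := by
    rw [Module.finrank_prod, Module.finrank_pi_fintype]
  have h3 : finrank ℂ (LinearMap.ker (shA H)) = finrank ℂ (⨅ l, H l : Submodule ℂ X) := by
    have hk : ∀ z : X × ((l : Fin s) → H l), z ∈ LinearMap.ker (shA H) ↔
        ∀ l, z.1 = (z.2 l : X) := by
      intro z
      rw [LinearMap.mem_ker, funext_iff]
      simp [shA, sub_eq_zero]
    refine LinearEquiv.finrank_eq
      { toFun := fun z => ⟨z.1.1, by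
          rw [Submodule.mem_iInf]
          intro l
          rw [(hk z.1).1 z.2 l]
          exact (z.1.2 l).2⟩
        invFun := fun x => ⟨(x.1, fun l => ⟨x.1, (Submodule.mem_iInf _).1 x.2 l⟩), by
          rw [hk]; intro l; rfl⟩
        left_inv := ?_
        right_inv := ?_
        map_add' := ?_
        map_smul' := ?_ }
    · intro z w; rfl
    · intro c z; rfl
    · intro z
      apply Subtype.ext
      refine Prod.ext rfl ?_
      ext l
      exact (hk z.1).1 z.2 l
    · intro x; rfl
  omega

theorem sh_frange_AB {s : ℕ} {X : Type*} [AddCommGroup X] [Module ℂ X] (H : Fin s → Submodule ℂ X)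
    (T : Fin s → X →ₗ[ℂ] X) (t : ℂ) :
    finrank ℂ (LinearMap.range (shA H + t • shB H T)) =
      finrank ℂ (shRR fun l => (H l).map (LinearMap.id + t • T l)) := by
  rw [sh_range_AB]

theorem sh_frange_A {s : ℕ} {X : Type*} [AddCommGroup X] [Module ℂ X] (H : Fin s → Submodule ℂ X) :
    finrank ℂ (LinearMap.range (shA H)) = finrank ℂ (shRR H) := by
  rw [sh_range_A]

theorem sh_RR_pencil {s : ℕ} {X : Type*} [AddCommGroup X] [Module ℂ X] [FiniteDimensional ℂ X]
    (H : Fin s → Submodule ℂ X) (T : Fin s → X →ₗ[ℂ] X) (t₀ : ℂ) :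
    ∀ᶠ t in 𝓝[≠] (0 : ℂ), finrank ℂ (shRR fun l => (H l).map (LinearMap.id + t₀ • T l)) ≤
      finrank ℂ (shRR fun l => (H l).map (LinearMap.id + t • T l)) := by
  have := sh_pencil (shA H) (shB H T) t₀
  simpa only [sh_frange_AB] using this

theorem sh_RR_pencil_zero {s : ℕ} {X : Type*} [AddCommGroup X] [Module ℂ X]
    [FiniteDimensional ℂ X] (H : Fin s → Submodule ℂ X) (T : Fin s → X →ₗ[ℂ] X) :
    ∀ᶠ t in 𝓝[≠] (0 : ℂ), finrank ℂ (shRR H) ≤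
      finrank ℂ (shRR fun l => (H l).map (LinearMap.id + t • T l)) := by
  have := sh_pencil_zero (shA H) (shB H T)
  simpa only [sh_frange_AB, sh_frange_A] using this

theorem sh_RR_deriv {s : ℕ} {X : Type*} [AddCommGroup X] [Module ℂ X] [FiniteDimensional ℂ X]
    (H : Fin s → Submodule ℂ X) (T : Fin s → X →ₗ[ℂ] X)
    (h : ∀ᶠ t in 𝓝[≠] (0 : ℂ), finrank ℂ (shRR fun l => (H l).map (LinearMap.id + t • T l)) ≤
      finrank ℂ (shRR H)) (x : X) (hx : ∀ l, x ∈ H l) : (fun l => T l x) ∈ shRR H := by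
  have := sh_pencil_deriv (shA H) (shB H T) (by simpa only [sh_frange_AB, sh_frange_A] using h)
    (x, fun l => ⟨x, hx l⟩) (by ext l; simp [shA])
  rw [sh_range_A] at this
  have h2 := neg_mem this
  convert h2 using 1
  ext l
  simp [shB]

theorem sh_RR_section {s : ℕ} {V Q : Type*} [AddCommGroup V] [Module ℂ V] [FiniteDimensional ℂ V]
    [AddCommGroup Q] [Module ℂ Q] [FiniteDimensional ℂ Q]
    (H : Fin s → Submodule ℂ (V →ₗ[ℂ] Q)) (T : Fin s → (V →ₗ[ℂ] Q) →ₗ[ℂ] (V →ₗ[ℂ] Q))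
    (h : ∀ᶠ t in 𝓝[≠] (0 : ℂ), finrank ℂ (shRR fun l => (H l).map (LinearMap.id + t • T l)) ≤
      finrank ℂ (shRR H)) (x : V →ₗ[ℂ] Q) (hx : ∀ l, x ∈ H l) :
    ∀ᶠ t in 𝓝[≠] (0 : ℂ), ∃ y, (∀ l, y ∈ (H l).map (LinearMap.id + t • T l)) ∧
      finrank ℂ (LinearMap.ker y) ≤ finrank ℂ (LinearMap.ker x) := by
  have := sh_pencil_section (shA H) (shB H T) (by simpa only [sh_frange_AB, sh_frange_A] using h)
    (LinearMap.fst _ _ _) (x, fun l => ⟨x, hx l⟩) (by ext l; simp [shA])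
  filter_upwards [this] with t ht
  obtain ⟨y, hy, hy2⟩ := ht
  refine ⟨y.1, fun l => ?_, hy2⟩
  have h3 := congrFun hy l
  rw [sh_AB_apply] at h3
  exact ⟨y.2 l, (y.2 l).2, (sub_eq_zero.1 h3).symm⟩

/-- Codimension comparison along a linear map. -/
theorem sh_codim {M M' : Type*} [AddCommGroup M] [Module ℂ M] [FiniteDimensional ℂ M]
    [AddCommGroup M'] [Module ℂ M'] [FiniteDimensional ℂ M'] (f : M →ₗ[ℂ] M')
    (R : Submodule ℂ M) (R' : Submodule ℂ M') (h : R'.comap f ≤ R) :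
    finrank ℂ M + finrank ℂ R' ≤ finrank ℂ M' + finrank ℂ R := by
  have h1 := Submodule.finrank_quotient_add_finrank R'
  have h2 := LinearMap.finrank_range_add_finrank_ker (R'.mkQ ∘ₗ f)
  have h3 : LinearMap.ker (R'.mkQ ∘ₗ f) ≤ R := by
    rw [LinearMap.ker_comp, Submodule.ker_mkQ]
    exact h
  have h4 := Submodule.finrank_mono h3
  have h5 := Submodule.finrank_le (LinearMap.range (R'.mkQ ∘ₗ f))
  omega

/-- Generic invertibility. -/
theorem sh_generic_bij {V : Type*} [AddCommGroup V] [Module ℂ V] [FiniteDimensional ℂ V]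
    (T : V →ₗ[ℂ] V) : ∀ᶠ t in 𝓝[≠] (0 : ℂ),
      Function.Bijective (LinearMap.id + t • T : V →ₗ[ℂ] V) := by
  filter_upwards [sh_pencil_zero LinearMap.id T] with t ht
  have h1 : LinearMap.range ((LinearMap.id : V →ₗ[ℂ] V) + t • T) = ⊤ := by
    apply Submodule.eq_top_of_finrank_eq
    apply le_antisymm (Submodule.finrank_le _)
    rw [LinearMap.range_id, finrank_top] at ht
    exact ht
  have h2 := LinearMap.range_eq_top.1 h1
  exact ⟨LinearMap.injective_iff_surjective.2 h2, h2⟩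

end Diag

/-! ### Flags -/

section Flags

theorem sh_flagAt_lt {m : ℕ} (G : Flagg m) (k : ℕ) (h : k < m) : flagAt G (k + 1) = G.F ⟨k, h⟩ := by
  simp [flagAt, h]

theorem sh_flagAt_finrank {m : ℕ} (G : Flagg m) (k : ℕ) (h : k ≤ m) :
    finrank ℂ (flagAt G k) = k := by
  cases k with
  | zero => exact finrank_bot ℂ _
  | succ k => rw [sh_flagAt_lt G k h, G.rank_eq]

theorem sh_flagAt_mono {m : ℕ} (G : Flagg m) : Monotone (flagAt G) := by
  intro a b hab
  rcases a with _ | a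
  · simp [flagAt]
  · rcases b with _ | b
    · omega
    · by_cases hb : b < m
      · rw [sh_flagAt_lt G b hb, sh_flagAt_lt G a (by omega)]
        exact G.mono (by simpa [Fin.le_def] using hab)
      · simp [flagAt, hb]

theorem sh_flagAt_top {m : ℕ} (G : Flagg m) : flagAt G m = ⊤ := by
  apply Submodule.eq_top_of_finrank_eq
  rw [sh_flagAt_finrank G m le_rfl]
  simp

theorem sh_adapted {m : ℕ} (F : Flagg m) (S : Submodule ℂ (Fin m → ℂ)) :
    ∃ b : Basis (Fin m) ℂ (Fin m → ℂ), (∀ k ≤ m, flagAt F k = Submodule.span ℂ (b '' {i | i.1 < k})) ∧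
      ∀ k ≤ m, S ⊓ flagAt F k ≤ Submodule.span ℂ (b '' {i | i.1 < k ∧ b i ∈ S}) := by
  classical
  have hstep : ∀ j : Fin m, ∃ v, v ∈ flagAt F (j + 1) ∧ v ∉ flagAt F j ∧
      (v ∉ S → S ⊓ flagAt F (j + 1) ≤ flagAt F j) := by
    intro j
    by_cases hS : S ⊓ flagAt F (j + 1) ≤ flagAt F j
    · have hlt : ¬ flagAt F (j + 1) ≤ flagAt F j := by
        intro hle
        have := Submodule.finrank_mono hle
        rw [sh_flagAt_finrank F _ j.2, sh_flagAt_finrank F _ j.2.le] at this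
        omega
      obtain ⟨v, hv, hv2⟩ := SetLike.not_le_iff_exists.1 hlt
      exact ⟨v, hv, hv2, fun _ => hS⟩
    · obtain ⟨v, hv, hv2⟩ := SetLike.not_le_iff_exists.1 hS
      exact ⟨v, hv.2, hv2, fun h => absurd hv.1 h⟩
  choose b hb1 hb2 hb3 using hstep
  have hdec : ∀ j : Fin m, ∀ v ∈ flagAt F (j + 1), ∃ c : ℂ, v - c • b j ∈ flagAt F j := by
    intro j v hv
    have hle : flagAt F j ⊔ Submodule.span ℂ {b j} ≤ flagAt F (j + 1) :=
      sup_le (sh_flagAt_mono F (Nat.le_succ _)) (by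
        rw [Submodule.span_singleton_le_iff_mem]; exact hb1 j)
    have hlt : flagAt F j < flagAt F j ⊔ Submodule.span ℂ {b j} := by
      refine lt_of_le_of_ne le_sup_left ?_
      intro h
      apply hb2 j
      rw [h]
      exact Submodule.mem_sup_right (Submodule.mem_span_singleton_self _)
    have h1 := Submodule.finrank_lt_finrank_of_lt hlt
    have h2 : flagAt F j ⊔ Submodule.span ℂ {b j} = flagAt F (j + 1) := by
      apply Submodule.eq_of_le_of_finrank_le hle
      rw [sh_flagAt_finrank F _ j.2]
      rw [sh_flagAt_finrank F _ j.2.le] at h1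
      exact h1
    rw [← h2] at hv
    obtain ⟨y, hy, z, hz, rfl⟩ := Submodule.mem_sup.1 hv
    obtain ⟨c, rfl⟩ := Submodule.mem_span_singleton.1 hz
    exact ⟨c, by simpa using hy⟩
  have hA : ∀ k ≤ m, flagAt F k ≤ Submodule.span ℂ (b '' {i | i.1 < k}) := by
    intro k
    induction k with
    | zero => intro _; simp [flagAt]
    | succ k ih =>
      intro hk v hv
      obtain ⟨c, hc⟩ := hdec ⟨k, hk⟩ v hv
      have h1 := ih (by omega) hc
      have h2 : Submodule.span ℂ (b '' {i | i.1 < k}) ≤ Submodule.span ℂ (b '' {i | i.1 < k + 1}) :=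
        Submodule.span_mono (Set.image_mono fun i (hi : i.1 < k) => Nat.lt_succ_of_lt hi)
      have h3 : b ⟨k, hk⟩ ∈ Submodule.span ℂ (b '' {i | i.1 < k + 1}) :=
        Submodule.subset_span ⟨⟨k, hk⟩, Nat.lt_succ_self k, rfl⟩
      have := add_mem (h2 h1) (Submodule.smul_mem _ c h3)
      simpa using this
  have hB : ∀ k ≤ m, S ⊓ flagAt F k ≤ Submodule.span ℂ (b '' {i | i.1 < k ∧ b i ∈ S}) := by
    intro k
    induction k with
    | zero => intro _; simp [flagAt]
    | succ k ih =>
      intro hk v hv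
      have h2 : Submodule.span ℂ (b '' {i | i.1 < k ∧ b i ∈ S}) ≤
          Submodule.span ℂ (b '' {i | i.1 < k + 1 ∧ b i ∈ S}) :=
        Submodule.span_mono (Set.image_mono
          fun i (hi : i.1 < k ∧ b i ∈ S) => ⟨Nat.lt_succ_of_lt hi.1, hi.2⟩)
      by_cases hbS : b ⟨k, hk⟩ ∈ S
      · obtain ⟨c, hc⟩ := hdec ⟨k, hk⟩ v hv.2
        have h1 := ih (by omega) ⟨sub_mem hv.1 (S.smul_mem c hbS), hc⟩
        have h3 : b ⟨k, hk⟩ ∈ Submodule.span ℂ (b '' {i | i.1 < k + 1 ∧ b i ∈ S}) :=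
          Submodule.subset_span ⟨⟨k, hk⟩, ⟨Nat.lt_succ_self k, hbS⟩, rfl⟩
        have := add_mem (h2 h1) (Submodule.smul_mem _ c h3)
        simpa using this
      · exact h2 (ih (by omega) ⟨hv.1, hb3 ⟨k, hk⟩ hbS hv⟩)
  have htop : ⊤ ≤ Submodule.span ℂ (Set.range b) := by
    rw [← sh_flagAt_top F]
    exact (hA m le_rfl).trans (Submodule.span_mono (Set.image_subset_range _ _))
  refine ⟨basisOfTopLeSpanOfCardEqFinrank b htop (by simp), ?_, ?_⟩
  · rw [coe_basisOfTopLeSpanOfCardEqFinrank]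
    intro k hk
    refine le_antisymm (hA k hk) ?_
    rw [Submodule.span_le]
    rintro _ ⟨i, hi, rfl⟩
    exact sh_flagAt_mono F (Nat.succ_le_of_lt hi) (hb1 i)
  · rw [coe_basisOfTopLeSpanOfCardEqFinrank]
    exact hB

/-- The image of a flag under an automorphism. -/
def shMapFlag {m : ℕ} (g : (Fin m → ℂ) ≃ₗ[ℂ] (Fin m → ℂ)) (F : Flagg m) : Flagg m where
  F := fun i => (F.F i).map g.toLinearMap
  mono := fun _ _ hij => Submodule.map_mono (F.mono hij)
  rank_eq := fun i => by
    rw [LinearEquiv.finrank_map_eq g, F.rank_eq]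

theorem sh_mapFlag_at {m : ℕ} (g : (Fin m → ℂ) ≃ₗ[ℂ] (Fin m → ℂ)) (F : Flagg m) (k : ℕ) :
    flagAt (shMapFlag g F) k = (flagAt F k).map g.toLinearMap := by
  rcases k with _ | k
  · simp [flagAt]
  · by_cases hk : k < m
    · rw [sh_flagAt_lt _ _ hk, sh_flagAt_lt _ _ hk]
      rfl
    · simp [flagAt, hk]

theorem sh_flag_trans {m : ℕ} (F F' : Flagg m) :
    ∃ g : (Fin m → ℂ) ≃ₗ[ℂ] (Fin m → ℂ), shMapFlag g F = F' := by
  obtain ⟨b, hb, -⟩ := sh_adapted F ⊤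
  obtain ⟨b', hb', -⟩ := sh_adapted F' ⊤
  refine ⟨b.equiv b' (Equiv.refl _), ?_⟩
  have h : ∀ i, (shMapFlag (b.equiv b' (Equiv.refl _)) F).F i = F'.F i := by
    intro i
    change (F.F i).map _ = _
    have h1 := sh_flagAt_lt F i i.2
    have h2 := sh_flagAt_lt F' i i.2
    simp only [Fin.eta] at h1 h2
    rw [← h1, ← h2, hb _ i.2, hb' _ i.2, Submodule.map_span, ← Set.image_comp]
    congr 1
    apply Set.image_congr
    intro a _
    simp
  cases F'
  simp only [shMapFlag] at h ⊢
  congr 1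
  funext i
  exact h i

/-- Filtered maps. -/
def shHom {ι M N : Type*} [AddCommGroup M] [Module ℂ M] [AddCommGroup N] [Module ℂ N]
    (W : ι → Submodule ℂ M) (U : ι → Submodule ℂ N) : Submodule ℂ (M →ₗ[ℂ] N) where
  carrier := {φ | ∀ j, ∀ v ∈ W j, φ v ∈ U j}
  add_mem' := by
    intro a b ha hb j v hv
    simpa using add_mem (ha j v hv) (hb j v hv)
  zero_mem' := by
    intro j v hv
    simp
  smul_mem' := by
    intro c a ha j v hv
    simpa using Submodule.smul_mem _ c (ha j v hv)

theorem sh_mem_hom {ι M N : Type*} [AddCommGroup M] [Module ℂ M] [AddCommGroup N] [Module ℂ N]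
    (W : ι → Submodule ℂ M) (U : ι → Submodule ℂ N) (φ : M →ₗ[ℂ] N) :
    φ ∈ shHom W U ↔ ∀ j, ∀ v ∈ W j, φ v ∈ U j := Iff.rfl

/-- Filtered maps between flagged spaces. -/
abbrev shHF {r q : ℕ} (F : Flagg r) (G : Flagg q) (a : Fin r → ℕ) :
    Submodule ℂ ((Fin r → ℂ) →ₗ[ℂ] (Fin q → ℂ)) := shHom F.F (fun j => flagAt G (a j))

theorem sh_LSpace {s r q : ℕ} (I : Fin s → Fin r → ℕ) (F : Fin s → Flagg r) (G : Fin s → Flagg q) :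
    LSpace I F G = ⨅ l, shHF (F l) (G l) (fun j => I l j - j) := by
  ext φ
  rw [Submodule.mem_iInf]
  rfl

theorem sh_mem_HF_basis {r : ℕ} {N : Type*} [AddCommGroup N] [Module ℂ N] (F : Flagg r)
    (U : Fin r → Submodule ℂ N) (hU : Monotone U) (b : Basis (Fin r) ℂ (Fin r → ℂ))
    (hb : ∀ k ≤ r, flagAt F k = Submodule.span ℂ (b '' {i | i.1 < k}))
    (φ : (Fin r → ℂ) →ₗ[ℂ] N) :
    φ ∈ shHom F.F U ↔ ∀ j, φ (b j) ∈ U j := by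
  have hF : ∀ j : Fin r, F.F j = Submodule.span ℂ (b '' {i | i.1 < j.1 + 1}) := by
    intro j
    rw [← hb _ j.2, sh_flagAt_lt F j j.2]
  constructor
  · intro h j
    apply h j
    rw [hF]
    exact Submodule.subset_span ⟨j, Nat.lt_succ_self _, rfl⟩
  · intro h j v hv
    rw [hF] at hv
    have : Submodule.span ℂ (b '' {i | i.1 < j.1 + 1}) ≤ (U j).comap φ := by
      rw [Submodule.span_le]
      rintro _ ⟨i, hi, rfl⟩
      have hij : i ≤ j := Nat.le_of_lt_succ hi
      exact hU hij (h i)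
    exact this hv

theorem sh_HF_finrank {r q : ℕ} (F : Flagg r) (G : Flagg q) (a : Fin r → ℕ) (ha : Monotone a)
    (haq : ∀ j, a j ≤ q) : finrank ℂ (shHF F G a) = ∑ j, a j := by
  obtain ⟨b, hb, -⟩ := sh_adapted F ⊤
  have hmem := sh_mem_HF_basis F (fun j => flagAt G (a j))
    (fun i j hij => sh_flagAt_mono G (ha hij)) b hb
  have e : shHF F G a ≃ₗ[ℂ] ((j : Fin r) → flagAt G (a j)) :=
    { toFun := fun φ j => ⟨φ.1 (b j), (hmem φ.1).1 φ.2 j⟩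
      invFun := fun z => ⟨b.constr ℂ fun j => (z j : Fin q → ℂ), by
        rw [hmem]
        intro j
        rw [Basis.constr_basis]
        exact (z j).2⟩
      map_add' := fun _ _ => rfl
      map_smul' := fun _ _ => rfl
      left_inv := fun φ => by
        apply Subtype.ext
        apply b.ext
        intro j
        simp
      right_inv := fun z => by
        funext j
        apply Subtype.ext
        simp }
  rw [e.finrank_eq, Module.finrank_pi_fintype]
  exact Finset.sum_congr rfl fun j _ => sh_flagAt_finrank G _ (haq j)

/-- Extension of filtered maps. -/
theorem sh_extend {r : ℕ} {N : Type*} [AddCommGroup N] [Module ℂ N] (F : Flagg r)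
    (U : Fin r → Submodule ℂ N) (hU : Monotone U) (S : Submodule ℂ (Fin r → ℂ))
    (γ : S →ₗ[ℂ] N) (hγ : γ ∈ shHom (fun j => (F.F j).comap S.subtype) U) :
    ∃ ψ ∈ shHom F.F U, ψ ∘ₗ S.subtype = γ := by
  classical
  obtain ⟨b, hb, hbS⟩ := sh_adapted F S
  obtain ⟨g, hg⟩ := LinearMap.exists_extend γ
  have hg' : ∀ v (hv : v ∈ S), g v = γ ⟨v, hv⟩ := fun v hv => LinearMap.congr_fun hg ⟨v, hv⟩
  let ψ : (Fin r → ℂ) →ₗ[ℂ] N := b.constr ℂ fun j => if b j ∈ S then g (b j) else 0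
  have hψ : ∀ j, ψ (b j) = if b j ∈ S then g (b j) else 0 := fun j => Basis.constr_basis _ _ _ _
  refine ⟨ψ, ?_, ?_⟩
  · rw [sh_mem_HF_basis F U hU b hb]
    intro j
    rw [hψ]
    split_ifs with h
    · rw [hg' _ h]
      apply hγ j
      change b j ∈ F.F j
      have h1 := sh_flagAt_lt F j j.2
      simp only [Fin.eta] at h1
      rw [← h1, hb _ j.2]
      exact Submodule.subset_span ⟨j, Nat.lt_succ_self _, rfl⟩
    · exact zero_mem _
  · rw [← hg]
    ext1 ⟨v, hv⟩
    have h1 : v ∈ Submodule.span ℂ (b '' {i | i.1 < r ∧ b i ∈ S}) :=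
      hbS r le_rfl ⟨hv, by rw [sh_flagAt_top]; trivial⟩
    have h2 : Submodule.span ℂ (b '' {i | i.1 < r ∧ b i ∈ S}) ≤ LinearMap.eqLocus ψ g := by
      rw [Submodule.span_le]
      rintro _ ⟨i, hi, rfl⟩
      change ψ (b i) = g (b i)
      rw [hψ, if_pos hi.2]
    exact h2 h1

/-- Post-composition. -/
def shPost {V Q : Type*} [AddCommGroup V] [Module ℂ V] [AddCommGroup Q] [Module ℂ Q]
    (h : Q →ₗ[ℂ] Q) : (V →ₗ[ℂ] Q) →ₗ[ℂ] (V →ₗ[ℂ] Q) where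
  toFun ψ := h ∘ₗ ψ
  map_add' a b := by ext1 v; simp
  map_smul' c a := by ext1 v; simp

/-- Pre-composition. -/
def shPre {V Q : Type*} [AddCommGroup V] [Module ℂ V] [AddCommGroup Q] [Module ℂ Q]
    (h : V →ₗ[ℂ] V) : (V →ₗ[ℂ] Q) →ₗ[ℂ] (V →ₗ[ℂ] Q) where
  toFun ψ := ψ ∘ₗ h
  map_add' a b := by ext1 v; simp
  map_smul' c a := by ext1 v; simp

theorem sh_post_pencil {V Q : Type*} [AddCommGroup V] [Module ℂ V] [AddCommGroup Q] [Module ℂ Q]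
    (h : Q →ₗ[ℂ] Q) (t : ℂ) : (LinearMap.id + t • shPost h : (V →ₗ[ℂ] Q) →ₗ[ℂ] (V →ₗ[ℂ] Q)) =
      shPost (LinearMap.id + t • h) := by
  ext ψ v
  simp [shPost]

theorem sh_pre_pencil {V Q : Type*} [AddCommGroup V] [Module ℂ V] [AddCommGroup Q] [Module ℂ Q]
    (h : V →ₗ[ℂ] V) (t : ℂ) : (LinearMap.id + t • shPre h : (V →ₗ[ℂ] Q) →ₗ[ℂ] (V →ₗ[ℂ] Q)) =
      shPre (LinearMap.id + t • h) := by
  ext ψ v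
  simp [shPre]

theorem sh_map_post {r q : ℕ} (F : Flagg r) (G : Flagg q) (a : Fin r → ℕ)
    (g : (Fin q → ℂ) ≃ₗ[ℂ] (Fin q → ℂ)) :
    (shHF F G a).map (shPost g.toLinearMap) = shHF F (shMapFlag g G) a := by
  ext ψ
  constructor
  · rintro ⟨ψ, hψ, rfl⟩ j v hv
    simp only
    rw [sh_mapFlag_at]
    exact ⟨_, hψ j v hv, rfl⟩
  · intro h
    refine ⟨g.symm.toLinearMap ∘ₗ ψ, ?_, ?_⟩
    · intro j v hv
      have := h j v hv
      simp only [sh_mapFlag_at] at this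
      obtain ⟨w, hw, hw2⟩ := this
      simp only [LinearMap.comp_apply, ← hw2]
      simpa using hw
    · ext1 v
      simp [shPost]

theorem sh_map_pre {ι M N : Type*} [AddCommGroup M] [Module ℂ M] [AddCommGroup N] [Module ℂ N]
    (W : ι → Submodule ℂ M) (U : ι → Submodule ℂ N) (g : M ≃ₗ[ℂ] M) :
    (shHom W U).map (shPre g.toLinearMap) =
      shHom (fun j => (W j).map g.symm.toLinearMap) U := by
  ext ψ
  constructor
  · rintro ⟨ψ, hψ, rfl⟩ j v ⟨w, hw, hw2⟩
    rw [← hw2]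
    simpa [shPre] using hψ j w hw
  · intro h
    refine ⟨ψ ∘ₗ g.symm.toLinearMap, ?_, ?_⟩
    · intro j v hv
      exact h j _ ⟨v, hv, rfl⟩
    · ext1 v
      simp [shPre]

end Flags

/-! ### Positions -/

section Positions

theorem sh_pos_step {m : ℕ} (F : Flagg m) (S : Submodule ℂ (Fin m → ℂ)) (j : ℕ) (hj : j < m) :
    finrank ℂ ↥(flagAt F (j + 1) ⊓ S) ≤ finrank ℂ ↥(flagAt F j ⊓ S) + 1 := by
  have h1 := Submodule.finrank_sup_add_finrank_inf_eq (flagAt F (j + 1) ⊓ S) (flagAt F j)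
  have h2 : finrank ℂ ↥(flagAt F (j + 1) ⊓ S ⊔ flagAt F j) ≤ j + 1 := by
    exact (Submodule.finrank_mono (sup_le inf_le_left (sh_flagAt_mono F (Nat.le_succ j)))).trans_eq
      (sh_flagAt_finrank F (j + 1) hj)
  have h3 : finrank ℂ ↥(flagAt F (j + 1) ⊓ S ⊓ flagAt F j) ≤ finrank ℂ ↥(flagAt F j ⊓ S) :=
    Submodule.finrank_mono (le_inf inf_le_right (inf_le_left.trans inf_le_right))
  rw [sh_flagAt_finrank F j hj.le] at h1
  omega

theorem sh_pos_ivt {m : ℕ} (F : Flagg m) (S : Submodule ℂ (Fin m → ℂ)) (k j : ℕ) (hj : j ≤ m)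
    (h : k + 1 ≤ finrank ℂ ↥(flagAt F j ⊓ S)) :
    ∃ i < j, finrank ℂ ↥(flagAt F (i + 1) ⊓ S) = k + 1 := by
  classical
  induction j with
  | zero =>
    have : flagAt F 0 ⊓ S = ⊥ := by simp [flagAt]
    rw [this, finrank_bot] at h
    omega
  | succ j ih =>
    by_cases h1 : k + 1 ≤ finrank ℂ ↥(flagAt F j ⊓ S)
    · obtain ⟨i, hi, hi2⟩ := ih (by omega) h1
      exact ⟨i, by omega, hi2⟩
    · have := sh_pos_step F S j hj
      exact ⟨j, by omega, by omega⟩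

theorem sh_posN_le {m : ℕ} (F : Flagg m) (S : Submodule ℂ (Fin m → ℂ)) (k : ℕ) (j : Fin m)
    (h : k + 1 ≤ finrank ℂ ↥(F.F j ⊓ S)) : posN F S k ≤ j := by
  have h1 := sh_flagAt_lt F j j.2
  simp only [Fin.eta] at h1
  rw [← h1] at h
  obtain ⟨i, hi, hi2⟩ := sh_pos_ivt F S k (j + 1) j.2 h
  have him : i < m := by omega
  rw [sh_flagAt_lt F i him] at hi2
  have : posN F S k ≤ i := Nat.sInf_le ⟨him, hi2⟩
  omega

theorem sh_posN_spec {m : ℕ} (F : Flagg m) (S : Submodule ℂ (Fin m → ℂ)) (k : ℕ)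
    (hk : k < finrank ℂ S) :
    ∃ h : posN F S k < m, finrank ℂ ↥(F.F ⟨posN F S k, h⟩ ⊓ S) = k + 1 := by
  have : k + 1 ≤ finrank ℂ ↥(flagAt F m ⊓ S) := by
    rw [sh_flagAt_top, top_inf_eq]; exact hk
  obtain ⟨i, hi, hi2⟩ := sh_pos_ivt F S k m le_rfl this
  rw [sh_flagAt_lt F i hi] at hi2
  exact Nat.sInf_mem (s := {j : ℕ | ∃ h : j < m, finrank ℂ ↥(F.F ⟨j, h⟩ ⊓ S) = k + 1})
    ⟨i, hi, hi2⟩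

theorem sh_posN_mono {m : ℕ} (F : Flagg m) (S : Submodule ℂ (Fin m → ℂ)) (k k' : ℕ)
    (hkk : k ≤ k') (hk : k' < finrank ℂ S) : posN F S k ≤ posN F S k' := by
  obtain ⟨h, h2⟩ := sh_posN_spec F S k' hk
  exact sh_posN_le F S k ⟨_, h⟩ (by omega)

theorem sh_finrank_comap {m d : ℕ} (S W : Submodule ℂ (Fin m → ℂ))
    (e : (Fin d → ℂ) ≃ₗ[ℂ] S) :
    finrank ℂ (W.comap (S.subtype ∘ₗ e.toLinearMap)) = finrank ℂ ↥(W ⊓ S) := by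
  have hinj : Function.Injective (S.subtype ∘ₗ e.toLinearMap) := by
    simpa using (Subtype.val_injective.comp e.injective)
  have hr : LinearMap.range (S.subtype ∘ₗ e.toLinearMap) = S := by
    rw [LinearMap.range_comp, LinearEquiv.range, Submodule.map_top, Submodule.range_subtype]
  rw [(Submodule.equivMapOfInjective _ hinj _).finrank_eq, Submodule.map_comap_eq, hr, inf_comm]

theorem sh_subflag {m d : ℕ} (F : Flagg m) (S : Submodule ℂ (Fin m → ℂ))
    (e : (Fin d → ℂ) ≃ₗ[ℂ] S) :
    ∃ F' : Flagg d, ∀ (j : Fin m) (k : Fin d), finrank ℂ ↥(F.F j ⊓ S) = k + 1 →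
      (F.F j).comap (S.subtype ∘ₗ e.toLinearMap) = F'.F k := by
  have hd : finrank ℂ S = d := by rw [← e.finrank_eq]; simp
  have hlt : ∀ k : Fin d, posN F S k < m := fun k => (sh_posN_spec F S k (by omega)).1
  have hsp : ∀ k : Fin d, finrank ℂ ↥(F.F ⟨posN F S k, hlt k⟩ ⊓ S) = k + 1 :=
    fun k => (sh_posN_spec F S k (by omega)).2
  refine ⟨⟨fun k => (F.F ⟨posN F S k, hlt k⟩).comap (S.subtype ∘ₗ e.toLinearMap), ?_, ?_⟩, ?_⟩
  · intro k k' hkk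
    apply Submodule.comap_mono
    apply F.mono
    exact sh_posN_mono F S k k' hkk (by omega)
  · intro k
    rw [sh_finrank_comap, hsp]
  · intro j k hjk
    symm
    apply Submodule.eq_of_le_of_finrank_le
    · apply Submodule.comap_mono
      apply F.mono
      exact sh_posN_le F S k j hjk.ge
    · rw [sh_finrank_comap, sh_finrank_comap, hsp, hjk]

end Positions

/-! ### The geometric steps -/

section Steps

open Filter Topology

theorem sh_factor {V Q N : Type*} [AddCommGroup V] [Module ℂ V] [AddCommGroup Q] [Module ℂ Q]
    [AddCommGroup N] [Module ℂ N] (φ : V →ₗ[ℂ] Q) (δ : V →ₗ[ℂ] N)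
    (h : LinearMap.ker φ ≤ LinearMap.ker δ) : ∃ η : Q →ₗ[ℂ] N, η ∘ₗ φ = δ := by
  obtain ⟨η, hη⟩ := LinearMap.exists_extend
    ((LinearMap.ker φ).liftQ δ h ∘ₗ φ.quotKerEquivRange.symm.toLinearMap)
  refine ⟨η, ?_⟩
  ext1 v
  have := LinearMap.congr_fun hη ⟨φ v, LinearMap.mem_range_self φ v⟩
  simp only [LinearMap.comp_apply, Submodule.subtype_apply] at this
  rw [LinearMap.comp_apply, this]
  have h2 : φ.quotKerEquivRange.symm ⟨φ v, LinearMap.mem_range_self φ v⟩ =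
      (LinearMap.ker φ).mkQ v := by
    rw [LinearEquiv.symm_apply_eq]
    rfl
  change (LinearMap.ker φ).liftQ δ h (φ.quotKerEquivRange.symm _) = _
  rw [h2]
  simp

theorem sh_RR_congr {s : ℕ} {X : Type*} [AddCommGroup X] [Module ℂ X]
    (H H' : Fin s → Submodule ℂ X) (h : ∀ l, H l = H' l) :
    finrank ℂ (shRR H) = finrank ℂ (shRR H') := by
  rw [funext h]

/-- The invariant `dim (diag + ∏ H_l)` of flags. -/
noncomputable abbrev shN {s r q : ℕ} (F : Fin s → Flagg r) (G : Fin s → Flagg q) (a : Fin s → Fin r → ℕ) : ℕ :=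
  finrank ℂ (shRR fun l => shHF (F l) (G l) (a l))

/-- Induced filtered maps on a subspace. -/
abbrev shHS {r q : ℕ} (S : Submodule ℂ (Fin r → ℂ)) (F : Flagg r) (G : Flagg q) (a : Fin r → ℕ) :
    Submodule ℂ (S →ₗ[ℂ] (Fin q → ℂ)) :=
  shHom (fun j => (F.F j).comap S.subtype) (fun j => flagAt G (a j))

theorem sh_core {s r q : ℕ} (a : Fin s → Fin r → ℕ) (ha : ∀ l, Monotone (a l))
    (F : Fin s → Flagg r) (G : Fin s → Flagg q) (φ : (Fin r → ℂ) →ₗ[ℂ] (Fin q → ℂ))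
    (hφ : ∀ l, φ ∈ shHF (F l) (G l) (a l)) (hmin : ∀ G' : Fin s → Flagg q, shN F G' a ≤ shN F G a) :
    finrank ℂ (Fin s → ((Fin r → ℂ) →ₗ[ℂ] (Fin q → ℂ))) +
        finrank ℂ (shRR fun l => shHS (LinearMap.ker φ) (F l) (G l) (a l)) ≤
      finrank ℂ (Fin s → (LinearMap.ker φ →ₗ[ℂ] (Fin q → ℂ))) + shN F G a := by
  set S := LinearMap.ker φ with hS
  let res : (Fin s → ((Fin r → ℂ) →ₗ[ℂ] (Fin q → ℂ))) →ₗ[ℂ] (Fin s → (S →ₗ[ℂ] (Fin q → ℂ))) :=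
    { toFun := fun z l => z l ∘ₗ S.subtype
      map_add' := fun _ _ => rfl
      map_smul' := fun _ _ => rfl }
  refine sh_codim res _ _ ?_
  intro α hα
  rw [Submodule.mem_comap, sh_mem_RR] at hα
  obtain ⟨β, hβ⟩ := hα
  obtain ⟨β', hβ'⟩ := LinearMap.exists_extend β
  have hext := fun l => sh_extend (F l) (fun j => flagAt (G l) (a l j))
    (fun i j hij => sh_flagAt_mono (G l) (ha l hij)) S _ (hβ l)
  choose γ hγ hγ2 using hext
  have hfac : ∀ l, ∃ η : (Fin q → ℂ) →ₗ[ℂ] (Fin q → ℂ), η ∘ₗ φ = α l - β' - γ l := by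
    intro l
    apply sh_factor
    intro v hv
    have h1 := LinearMap.congr_fun (hγ2 l) ⟨v, hv⟩
    have h2 := LinearMap.congr_fun hβ' ⟨v, hv⟩
    simp only [LinearMap.comp_apply, Submodule.subtype_apply] at h1 h2
    rw [LinearMap.mem_ker, LinearMap.sub_apply, LinearMap.sub_apply, h1, h2]
    simp [res]
  choose η hη using hfac
  have hd := sh_RR_deriv (fun l => shHF (F l) (G l) (a l)) (fun l => shPost (η l)) (by
    have hb : ∀ᶠ t in 𝓝[≠] (0 : ℂ), ∀ l, Function.Bijective
        (LinearMap.id + t • η l : (Fin q → ℂ) →ₗ[ℂ] (Fin q → ℂ)) :=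
      eventually_all.2 fun l => sh_generic_bij (η l)
    filter_upwards [hb] with t ht
    have he : ∀ l, (shHF (F l) (G l) (a l)).map (LinearMap.id + t • shPost (η l)) =
        shHF (F l) (shMapFlag (LinearEquiv.ofBijective _ (ht l)) (G l)) (a l) := by
      intro l
      rw [← sh_map_post, sh_post_pencil]
      rfl
    exact (sh_RR_congr _ _ he).trans_le
      (hmin fun l => shMapFlag (LinearEquiv.ofBijective _ (ht l)) (G l))) φ hφ
  rw [sh_mem_RR] at hd ⊢
  obtain ⟨x, hx⟩ := hd
  refine ⟨β' + x, fun l => ?_⟩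
  have h1 : α l - (β' + x) = (shPost (η l) φ - x) + γ l := by
    have : shPost (η l) φ = α l - β' - γ l := hη l
    rw [this]; abel
  rw [h1]
  exact add_mem (hx l) (hγ l)

theorem sh_step1 {s r d q : ℕ} (a : Fin s → Fin r → ℕ) (a' : Fin s → Fin d → ℕ)
    (F : Fin s → Flagg r) (G₀ : Fin s → Flagg q) (φ₀ : (Fin r → ℂ) →ₗ[ℂ] (Fin q → ℂ))
    (hφ : ∀ l, φ₀ ∈ shHF (F l) (G₀ l) (a l)) (hmin : ∀ G' : Fin s → Flagg q, shN F G' a ≤ shN F G₀ a)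
    (F' : Fin s → Flagg d) (G' : Fin s → Flagg q) :
    ∃ (G : Fin s → Flagg q) (φ : (Fin r → ℂ) →ₗ[ℂ] (Fin q → ℂ)),
      (∀ l, φ ∈ shHF (F l) (G l) (a l)) ∧ shN F G₀ a ≤ shN F G a ∧
      finrank ℂ (LinearMap.ker φ) ≤ finrank ℂ (LinearMap.ker φ₀) ∧ shN F' G' a' ≤ shN F' G a' := by
  choose h hh using fun l => sh_flag_trans (G₀ l) (G' l)
  let T : Fin s → (Fin q → ℂ) →ₗ[ℂ] (Fin q → ℂ) := fun l => (h l).toLinearMap - LinearMap.id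
  have hb : ∀ᶠ t in 𝓝[≠] (0 : ℂ), ∀ l, Function.Bijective
      (LinearMap.id + t • T l : (Fin q → ℂ) →ₗ[ℂ] (Fin q → ℂ)) :=
    eventually_all.2 fun l => sh_generic_bij (T l)
  have he : ∀ {m : ℕ} (F : Fin s → Flagg m) (a : Fin s → Fin m → ℕ) (t : ℂ)
      (ht : ∀ l, Function.Bijective
        (LinearMap.id + t • T l : (Fin q → ℂ) →ₗ[ℂ] (Fin q → ℂ))) (l : Fin s),
      (shHF (F l) (G₀ l) (a l)).map (LinearMap.id + t • shPost (T l)) =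
        shHF (F l) (shMapFlag (LinearEquiv.ofBijective _ (ht l)) (G₀ l)) (a l) := by
    intro m F a t ht l
    rw [← sh_map_post, sh_post_pencil]
    rfl
  have h1 : ∀ l, (shHF (F' l) (G₀ l) (a' l)).map (LinearMap.id + (1 : ℂ) • shPost (T l)) =
        shHF (F' l) (G' l) (a' l) := by
    intro l
    rw [← hh l, ← sh_map_post, sh_post_pencil]
    congr 2
    ext v : 1
    simp [T]
  have hgen := sh_RR_pencil (fun l => shHF (F' l) (G₀ l) (a' l)) (fun l => shPost (T l)) 1
  have hgen0 := sh_RR_pencil_zero (fun l => shHF (F l) (G₀ l) (a l)) (fun l => shPost (T l))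
  have hsec := sh_RR_section (fun l => shHF (F l) (G₀ l) (a l)) (fun l => shPost (T l)) (by
    filter_upwards [hb] with t ht
    exact (sh_RR_congr _ _ (he F a t ht)).trans_le (hmin _)) φ₀ hφ
  obtain ⟨t, ht, ht1, ht2, φ, hφ1, hφ2⟩ := (hb.and (hgen.and (hgen0.and hsec))).exists
  refine ⟨fun l => shMapFlag (LinearEquiv.ofBijective _ (ht l)) (G₀ l), φ,
    fun l => he F a t ht l ▸ hφ1 l, ht2.trans (sh_RR_congr _ _ (he F a t ht)).le, hφ2, ?_⟩
  exact (sh_RR_congr _ _ h1).ge.trans (ht1.trans (sh_RR_congr _ _ (he F' a' t ht)).le)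

theorem sh_step2 {s r d q : ℕ} (a : Fin s → Fin r → ℕ) (a' : Fin s → Fin d → ℕ)
    (F : Fin s → Flagg r) (G : Fin s → Flagg q) (φ : (Fin r → ℂ) →ₗ[ℂ] (Fin q → ℂ))
    (hφ : ∀ l, φ ∈ shHF (F l) (G l) (a l)) (hd : finrank ℂ (LinearMap.ker φ) = d)
    (haa : ∀ l j (k : Fin d), finrank ℂ ↥((F l).F j ⊓ LinearMap.ker φ) = k + 1 → a' l k ≤ a l j)
    (F' : Fin s → Flagg d) :
    ∃ Ft : Fin s → Flagg r, (∀ l, φ ∈ shHF (Ft l) (G l) (a l)) ∧ shN F G a ≤ shN Ft G a ∧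
      shN F' G a' ≤ finrank ℂ (shRR fun l => shHS (LinearMap.ker φ) (Ft l) (G l) (a l)) := by
  set S := LinearMap.ker φ with hS
  let e : (Fin d → ℂ) ≃ₗ[ℂ] S := LinearEquiv.ofFinrankEq _ _ (by simp [hd])
  choose FS hFS using fun l => sh_subflag (F l) S e
  choose g hg using fun l => sh_flag_trans (F' l) (FS l)
  let θ : Fin s → S ≃ₗ[ℂ] S := fun l => e.symm ≪≫ₗ g l ≪≫ₗ e
  obtain ⟨pr, hpr⟩ := LinearMap.exists_leftInverse_of_injective S.subtype S.ker_subtype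
  have hpr' : ∀ v : S, pr v = v := fun v => LinearMap.congr_fun hpr v
  let TS : Fin s → S →ₗ[ℂ] S := fun l => (θ l).toLinearMap - LinearMap.id
  let T : Fin s → (Fin r → ℂ) →ₗ[ℂ] (Fin r → ℂ) := fun l => S.subtype ∘ₗ TS l ∘ₗ pr
  have hTφ : ∀ l v, φ (T l v) = 0 := fun l v => (TS l (pr v)).2
  have hb : ∀ᶠ t in 𝓝[≠] (0 : ℂ), ∀ l, Function.Bijective
      (LinearMap.id + t • T l : (Fin r → ℂ) →ₗ[ℂ] (Fin r → ℂ)) :=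
    eventually_all.2 fun l => sh_generic_bij (T l)
  have hgen0 := sh_RR_pencil_zero (fun l => shHF (F l) (G l) (a l)) (fun l => shPre (T l))
  have hgenS := sh_RR_pencil (fun l => shHS S (F l) (G l) (a l)) (fun l => shPre (TS l)) 1
  obtain ⟨t, ht, ht0, htS⟩ := (hb.and (hgen0.and hgenS)).exists
  have he : ∀ l, (shHF (F l) (G l) (a l)).map (LinearMap.id + t • shPre (T l)) =
      shHF (shMapFlag (LinearEquiv.ofBijective _ (ht l)).symm (F l)) (G l) (a l) := by
    intro l
    have := sh_map_pre (F l).F (fun j => flagAt (G l) (a l j)) (LinearEquiv.ofBijective _ (ht l))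
    rw [sh_pre_pencil]
    exact this
  refine ⟨fun l => shMapFlag (LinearEquiv.ofBijective _ (ht l)).symm (F l), ?_, ?_, ?_⟩
  · intro l
    simp only
    rw [← he]
    refine ⟨φ, hφ l, ?_⟩
    rw [sh_pre_pencil]
    refine LinearMap.ext fun v => ?_
    simp [shPre, hTφ]
  · exact ht0.trans (sh_RR_congr _ _ he).le
  · have hA : shN F' G a' ≤ finrank ℂ (shRR fun l =>
        (shHS S (F l) (G l) (a l)).map (LinearMap.id + (1 : ℂ) • shPre (TS l))) := by
      let res : (Fin s → (S →ₗ[ℂ] (Fin q → ℂ))) →ₗ[ℂ] (Fin s → ((Fin d → ℂ) →ₗ[ℂ] (Fin q → ℂ))) :=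
        { toFun := fun z l => z l ∘ₗ e.toLinearMap
          map_add' := fun _ _ => rfl
          map_smul' := fun _ _ => rfl }
      have hc := sh_codim res (shRR fun l =>
        (shHS S (F l) (G l) (a l)).map (LinearMap.id + (1 : ℂ) • shPre (TS l)))
        (shRR fun l => shHF (F' l) (G l) (a' l)) (by
        intro z hz
        rw [Submodule.mem_comap, sh_mem_RR] at hz
        rw [sh_mem_RR]
        obtain ⟨x, hx⟩ := hz
        refine ⟨x ∘ₗ e.symm.toLinearMap, fun l => ?_⟩
        refine ⟨(z l - x ∘ₗ e.symm.toLinearMap) ∘ₗ (θ l).symm.toLinearMap, ?_, ?_⟩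
        · intro j v hv
          rcases hm : finrank ℂ ↥((F l).F j ⊓ S) with _ | k
          · have hbot := Submodule.finrank_eq_zero.1 hm
            have h0 : (v : Fin r → ℂ) ∈ (F l).F j ⊓ S := ⟨hv, v.2⟩
            rw [hbot, Submodule.mem_bot] at h0
            have : v = 0 := Subtype.ext h0
            rw [this, map_zero]
            exact zero_mem _
          · have hkd : k < d := by
              have := Submodule.finrank_mono (inf_le_right : (F l).F j ⊓ S ≤ S)
              omega
            have h1 := hFS l j ⟨k, hkd⟩ hm
            have h2 : e.symm v ∈ (FS l).F ⟨k, hkd⟩ := by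
              rw [← h1]
              simpa using hv
            rw [← hg l] at h2
            obtain ⟨w, hw, hw2⟩ := h2
            have h3 : (θ l).symm v = e w := by
              rw [LinearEquiv.symm_apply_eq]
              simp only [θ, LinearEquiv.trans_apply, LinearEquiv.symm_apply_apply]
              rw [← LinearEquiv.symm_apply_eq]
              exact hw2.symm
            have h4 := hx l ⟨k, hkd⟩ w hw
            have h5 := sh_flagAt_mono (G l) (haa l j ⟨k, hkd⟩ hm) h4
            simp only [LinearMap.comp_apply, LinearEquiv.coe_coe, h3]
            simpa [res] using h5
        · rw [sh_pre_pencil]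
          ext1 v
          simp [shPre, TS])
      have hdim : finrank ℂ (Fin s → (S →ₗ[ℂ] (Fin q → ℂ))) =
          finrank ℂ (Fin s → ((Fin d → ℂ) →ₗ[ℂ] (Fin q → ℂ))) := by
        simp [Module.finrank_linearMap, hd, Module.finrank_pi_fintype]
      unfold shN
      omega
    refine hA.trans (htS.trans (Submodule.finrank_mono (sh_RR_mono fun l => ?_)))
    rintro _ ⟨γ, hγ, rfl⟩ j v hv
    rw [sh_pre_pencil]
    obtain ⟨w, hw, hw2⟩ := hv
    have h1 : (LinearMap.id + t • T l : (Fin r → ℂ) →ₗ[ℂ] (Fin r → ℂ)) v = w := by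
      have : (LinearEquiv.ofBijective _ (ht l)) v = w := by
        rw [← LinearEquiv.eq_symm_apply]
        exact hw2.symm
      exact this
    apply hγ j
    change (((LinearMap.id + t • TS l : S →ₗ[ℂ] S) v : S) : Fin r → ℂ) ∈ (F l).F j
    have h2 : (((LinearMap.id + t • TS l : S →ₗ[ℂ] S) v : S) : Fin r → ℂ) = w := by
      rw [← h1]
      simp [T, hpr']
    rw [h2]
    exact hw

end Steps

/-! ### Numerics and the final assembly -/

section Final

theorem sh_defect {s r q : ℕ} (f : Fin s → Fin r → ℕ) (hf : ∀ l (j : Fin r), (j : ℕ) ≤ f l j)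
    (hm : ∀ l, Monotone fun j : Fin r => f l j - (j : ℕ)) (hq : ∀ l j, f l j - (j : ℕ) ≤ q)
    (F : Fin s → Flagg r) (G : Fin s → Flagg q) :
    (finrank ℂ (LSpace f F G) : ℤ) - edimN (q + r) f =
      (s : ℤ) * r * q - shN F G (fun l j => f l j - (j : ℕ)) := by
  have h1 := sh_euler fun l => shHF (F l) (G l) (fun j => f l j - (j : ℕ))
  rw [← sh_LSpace] at h1
  have h2 : ∀ l, finrank ℂ (shHF (F l) (G l) (fun j => f l j - (j : ℕ))) =
      ∑ j, (f l j - (j : ℕ)) := fun l => sh_HF_finrank _ _ _ (hm l) (hq l)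
  rw [Finset.sum_congr rfl (fun l _ => h2 l), Module.finrank_linearMap] at h1
  simp only [Module.finrank_fin_fun] at h1
  have h3 : ∀ l, dimN (f l) = ((∑ j, (f l j - (j : ℕ)) : ℕ) : ℤ) := by
    intro l
    rw [dimN, Nat.cast_sum]
    exact Finset.sum_congr rfl fun j _ => (Nat.cast_sub (hf l j)).symm
  have h4 : edimN (q + r) f = (r : ℤ) * q - s * (r * q) +
      ((∑ l, ∑ j, (f l j - (j : ℕ)) : ℕ) : ℤ) := by
    rw [edimN, Finset.sum_sub_distrib, Finset.sum_congr rfl (fun l _ => h3 l)]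
    simp only [Finset.sum_const, Finset.card_univ, Fintype.card_fin, nsmul_eq_mul]
    push_cast
    ring
  rw [h4]
  have h5 : ((finrank ℂ (shRR fun l => shHF (F l) (G l) (fun j => f l j - (j : ℕ))) : ℕ) : ℤ) +
      (finrank ℂ (LSpace f F G) : ℤ) = (r : ℤ) * q +
      ((∑ l, ∑ j, (f l j - (j : ℕ)) : ℕ) : ℤ) := by
    exact_mod_cast h1
  unfold shN
  linear_combination h5

theorem sh_finrank_pi_hom (s q : ℕ) (V : Type) [AddCommGroup V] [Module ℂ V]
    [FiniteDimensional ℂ V] :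
    finrank ℂ (Fin s → (V →ₗ[ℂ] (Fin q → ℂ))) = s * finrank ℂ V * q := by
  rw [Module.finrank_pi_fintype]
  simp [Module.finrank_linearMap, mul_assoc]

theorem sh_N_le {s r q : ℕ} (F : Fin s → Flagg r) (G : Fin s → Flagg q) (a : Fin s → Fin r → ℕ) :
    shN F G a ≤ s * r * q := by
  have := Submodule.finrank_le (shRR fun l => shHF (F l) (G l) (a l))
  rw [sh_finrank_pi_hom, Module.finrank_fin_fun] at this
  exact this

/-- The set `Pkt`. -/
def shPkt {s : ℕ} (r q : ℕ) (f : Fin s → Fin r → ℕ) (F : Fin s → Flagg r) (G : Fin s → Flagg q)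
    (φ : (Fin r → ℂ) →ₗ[ℂ] (Fin q → ℂ)) : Prop :=
  φ ∈ LSpace f F G ∧ finrank ℂ (LSpace f F G) = tdim r q f ∧
    finrank ℂ (LinearMap.ker φ) = kdim r q f

theorem sh_pkt_exists {s r q : ℕ} (f : Fin s → Fin r → ℕ) (h : 1 ≤ kdim r q f) :
    ∃ F G φ, shPkt r q f F G φ := by
  have hne : {m : ℕ | ∃ (F : Fin s → Flagg r) (G : Fin s → Flagg q)
      (φ : (Fin r → ℂ) →ₗ[ℂ] (Fin q → ℂ)), φ ∈ LSpace f F G ∧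
      finrank ℂ (LSpace f F G) = tdim r q f ∧ finrank ℂ (LinearMap.ker φ) = m}.Nonempty := by
    by_contra hcon
    rw [Set.not_nonempty_iff_eq_empty] at hcon
    rw [kdim, hcon, Nat.sInf_empty] at h
    omega
  obtain ⟨F, G, φ, h1, h2, h3⟩ := Nat.sInf_mem hne
  exact ⟨F, G, φ, h1, h2, h3⟩

theorem sh_tdim_le {s r q : ℕ} (f : Fin s → Fin r → ℕ) (F : Fin s → Flagg r)
    (G : Fin s → Flagg q) : tdim r q f ≤ finrank ℂ (LSpace f F G) :=
  Nat.sInf_le ⟨F, G, rfl⟩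

theorem sh_tdim_exists {s r q : ℕ} (f : Fin s → Fin r → ℕ) (F : Fin s → Flagg r)
    (G : Fin s → Flagg q) : ∃ (F : Fin s → Flagg r) (G : Fin s → Flagg q),
      finrank ℂ (LSpace f F G) = tdim r q f :=
  Nat.sInf_mem (s := {m : ℕ | ∃ (F : Fin s → Flagg r) (G : Fin s → Flagg q),
    finrank ℂ (LSpace f F G) = m}) ⟨_, F, G, rfl⟩

theorem sh_kdim_le {s r q : ℕ} (f : Fin s → Fin r → ℕ) (F : Fin s → Flagg r)
    (G : Fin s → Flagg q) (φ : (Fin r → ℂ) →ₗ[ℂ] (Fin q → ℂ)) (h1 : φ ∈ LSpace f F G)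
    (h2 : finrank ℂ (LSpace f F G) = tdim r q f) : kdim r q f ≤ finrank ℂ (LinearMap.ker φ) :=
  Nat.sInf_le ⟨F, G, φ, h1, h2, rfl⟩

theorem sh_kPos_le {s r q : ℕ} (f : Fin s → Fin r → ℕ) (F : Fin s → Flagg r)
    (G : Fin s → Flagg q) (φ : (Fin r → ℂ) →ₗ[ℂ] (Fin q → ℂ)) (h : shPkt r q f F G φ)
    (l : Fin s) (k : ℕ) : kPosFun r q f l k ≤ posN (F l) (LinearMap.ker φ) k :=
  Nat.sInf_le ⟨F, G, φ, h.1, h.2.1, h.2.2, rfl⟩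

theorem sh_kPos_exists {s r q : ℕ} (f : Fin s → Fin r → ℕ) (h : 1 ≤ kdim r q f)
    (l : Fin s) (k : ℕ) : ∃ F G φ, shPkt r q f F G φ ∧
      posN (F l) (LinearMap.ker φ) k = kPosFun r q f l k := by
  obtain ⟨F, G, φ, h1, h2, h3⟩ := sh_pkt_exists f h
  obtain ⟨F, G, φ, h1, h2, h3, h4⟩ := Nat.sInf_mem
    (s := {p : ℕ | ∃ (F : Fin s → Flagg r) (G : Fin s → Flagg q)
      (φ : (Fin r → ℂ) →ₗ[ℂ] (Fin q → ℂ)), φ ∈ LSpace f F G ∧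
      finrank ℂ (LSpace f F G) = tdim r q f ∧
      finrank ℂ (LinearMap.ker φ) = kdim r q f ∧ posN (F l) (LinearMap.ker φ) k = p})
    ⟨_, F, G, φ, h1, h2, h3, rfl⟩
  exact ⟨F, G, φ, ⟨h1, h2, h3⟩, h4⟩

theorem sh_kPos_lt {s r q : ℕ} (f : Fin s → Fin r → ℕ) (h : 1 ≤ kdim r q f)
    (l : Fin s) (k : ℕ) (hk : k < kdim r q f) : kPosFun r q f l k < r := by
  obtain ⟨F, G, φ, h1, h2⟩ := sh_kPos_exists f h l k
  rw [← h2]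
  exact (sh_posN_spec (F l) _ k (h1.2.2 ▸ hk)).1

theorem sh_kPos_mono {s r q : ℕ} (f : Fin s → Fin r → ℕ) (h : 1 ≤ kdim r q f)
    (l : Fin s) (k k' : ℕ) (hkk : k ≤ k') (hk : k' < kdim r q f) :
    kPosFun r q f l k ≤ kPosFun r q f l k' := by
  obtain ⟨F, G, φ, h1, h2⟩ := sh_kPos_exists f h l k'
  rw [← h2]
  exact (sh_kPos_le f F G φ h1 l k).trans (sh_posN_mono (F l) _ k k' hkk (h1.2.2 ▸ hk))

theorem sh_flag_exists {m : ℕ} (d : ℕ) (hd : d ≤ m) (F : Flagg m) : Nonempty (Flagg d) := by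
  have e : (Fin d → ℂ) ≃ₗ[ℂ] (flagAt F d) := LinearEquiv.ofFinrankEq _ _ (by
    rw [sh_flagAt_finrank F d hd]; simp)
  obtain ⟨F', -⟩ := sh_subflag F _ e
  exact ⟨F'⟩

theorem sh_sub_facts {r n : ℕ} (g : Fin r → Fin n) (hg : StrictMono g) :
    (∀ j : Fin r, (j : ℕ) ≤ g j) ∧ (Monotone fun j : Fin r => (g j : ℕ) - (j : ℕ)) ∧
      ∀ j : Fin r, (g j : ℕ) - (j : ℕ) ≤ n - r := by
  have key : ∀ (t : ℕ) (i j : Fin r), (j : ℕ) = i + t → (g i : ℕ) + t ≤ g j := by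
    intro t
    induction t with
    | zero =>
      intro i j h
      have : i = j := Fin.ext (by omega)
      rw [this]; omega
    | succ t ih =>
      intro i j h
      have h1 := ih i ⟨i + t, by have := j.2; omega⟩ rfl
      have h2 : g ⟨i + t, by have := j.2; omega⟩ < g j := hg (by rw [Fin.lt_def]; simp only; omega)
      rw [Fin.lt_def] at h2
      omega
  refine ⟨fun j => ?_, fun i j hij => ?_, fun j => ?_⟩
  · have := key j ⟨0, by have := j.2; omega⟩ j (by simp)
    omega
  · have h1 := key (j - i) i j (by have := Fin.le_def.1 hij; omega)
    have := Fin.le_def.1 hij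
    simp only
    omega
  · have h1 := key (r - 1 - j) j ⟨r - 1, by have := j.2; omega⟩ (by simp only; omega)
    have h2 := (g ⟨r - 1, by have := j.2; omega⟩).2
    omega

theorem sh_main {s r q d : ℕ} (f : Fin s → Fin r → ℕ) (hf : ∀ l (j : Fin r), (j : ℕ) ≤ f l j)
    (hm : ∀ l, Monotone fun j : Fin r => f l j - (j : ℕ)) (hq : ∀ l j, f l j - (j : ℕ) ≤ q)
    (hd : kdim r q f = d) (hk : 1 ≤ kdim r q f) (hkr : d ≤ r) (f' : Fin s → Fin d → ℕ)
    (hs : 0 < s)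
    (hf' : ∀ l k, f' l k = applyN (f l) (kPosFun r q f l k) - kPosFun r q f l k + k) :
    0 ≤ (tdim r q f : ℤ) - edimN (q + r) f ∧
    (tdim r q f : ℤ) - edimN (q + r) f ≤
      (tdim d q f' : ℤ) - edimN (q + d) f' := by
  set a : Fin s → Fin r → ℕ := fun l j => f l j - (j : ℕ) with ha
  have hlt : ∀ l (k : Fin d), kPosFun r q f l k < r := fun l k => sh_kPos_lt f hk l k (hd ▸ k.2)
  have hf'a : ∀ l k, f' l k - (k : ℕ) = a l ⟨_, hlt l k⟩ := by
    intro l k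
    rw [hf', applyN, dif_pos (hlt l k)]
    simp only [ha]
    omega
  have hdef' := sh_defect (q := q) f' (fun l k => by rw [hf']; omega)
    (fun l k k' hkk => by
      simp only [hf'a]
      exact hm l (sh_kPos_mono f hk l k k' hkk (hd ▸ k'.2)))
    (fun l k => by rw [hf'a]; exact hq l _)
  have hdef : ∀ (F : Fin s → Flagg r) (G : Fin s → Flagg q),
      (finrank ℂ (LSpace f F G) : ℤ) - edimN (q + r) f = (s : ℤ) * r * q - shN F G a :=
    sh_defect f hf hm hq
  obtain ⟨F, G₀, φ₀, hp1, hp2, hp3⟩ := sh_pkt_exists f hk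
  have hmem : ∀ (F : Fin s → Flagg r) (G : Fin s → Flagg q) (φ : (Fin r → ℂ) →ₗ[ℂ] (Fin q → ℂ)),
      φ ∈ LSpace f F G ↔ ∀ l, φ ∈ shHF (F l) (G l) (a l) := by
    intro F G φ
    rw [sh_LSpace, Submodule.mem_iInf]
  have hmax : ∀ (F₁ : Fin s → Flagg r) (G₁ : Fin s → Flagg q),
      shN F₁ G₁ a ≤ shN F G₀ a := by
    intro F₁ G₁
    have h1 := hdef F G₀
    have h2 := hdef F₁ G₁
    have h3 := sh_tdim_le f F₁ G₁
    rw [← hp2] at h3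
    omega
  have hopt : ∀ (F₁ : Fin s → Flagg r) (G₁ : Fin s → Flagg q),
      shN F G₀ a ≤ shN F₁ G₁ a → finrank ℂ (LSpace f F₁ G₁) = tdim r q f := by
    intro F₁ G₁ h
    have h0 := hmax F₁ G₁
    have h1 := hdef F G₀
    have h2 := hdef F₁ G₁
    rw [← hp2]
    omega
  have hD := hdef F G₀
  rw [hp2] at hD
  refine ⟨?_, ?_⟩
  · rw [hD]
    have := sh_N_le F G₀ a
    have : (shN F G₀ a : ℤ) ≤ (s : ℤ) * r * q := by exact_mod_cast this
    linarith
  obtain ⟨Fd⟩ := sh_flag_exists d hkr (F ⟨0, hs⟩)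
  obtain ⟨F', G', hFG⟩ := sh_tdim_exists f' (fun _ => Fd) G₀
  have hD' := hdef' F' G'
  rw [hFG] at hD'
  set a' : Fin s → Fin d → ℕ := fun l k => f' l k - (k : ℕ) with ha'
  obtain ⟨G, φ, h1, h2, h3, h4⟩ := sh_step1 a a' F G₀ φ₀ ((hmem _ _ _).1 hp1)
    (fun G' => hmax F G') F' G'
  have hkd : finrank ℂ (LinearMap.ker φ) = d := by
    refine le_antisymm (h3.trans (hp3.trans hd).le) ?_
    rw [← hd]
    exact sh_kdim_le f F G φ ((hmem _ _ _).2 h1) (hopt F G h2)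
  have hpk : shPkt r q f F G φ := ⟨(hmem _ _ _).2 h1, hopt F G h2, hkd.trans hd.symm⟩
  obtain ⟨Ft, h5, h6, h7⟩ := sh_step2 a a' F G φ h1 hkd (by
    intro l j k hjk
    have h8 := (sh_kPos_le f F G φ hpk l k).trans (sh_posN_le (F l) _ k j hjk.ge)
    simp only [ha', hf'a]
    exact hm l (show (⟨_, hlt l k⟩ : Fin r) ≤ j from h8)) F'
  have h8 := sh_core a hm Ft G φ h5 (fun G' => (hmax Ft G').trans (h2.trans h6))
  rw [sh_finrank_pi_hom, sh_finrank_pi_hom, hkd, Module.finrank_fin_fun] at h8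
  have h9 := hmax Ft G
  have h10 : s * r * q + shN F' G' a' ≤ s * d * q + shN F G₀ a := by omega
  have h11 : (s : ℤ) * r * q + shN F' G' a' ≤ (s : ℤ) * d * q + shN F G₀ a := by
    exact_mod_cast h10
  rw [hD, hD']
  linarith

end Final

/-- **Sherman's relation.** If `1 ≤ kdim 𝐈 ≤ r - 1` and `𝐉 = kPos(𝐈)` then
`0 ≤ tdim 𝐈 - edim 𝐈 ≤ tdim(𝐈^𝐉) - edim(𝐈^𝐉)`. -/
theorem sherman_relation (s r n : ℕ) (hs : 2 ≤ s) (hr : 1 ≤ r) (hrn : r ≤ n)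
    (I : Fin s → Fin r → Fin n) (hI : ∀ l, StrictMono (I l))
    (hk1 : 1 ≤ kdimI I) (hk2 : kdimI I ≤ r - 1) :
    0 ≤ (tdim r (n - r) (Iraw I) : ℤ) - edim I ∧
      (tdim r (n - r) (Iraw I) : ℤ) - edim I ≤
        (tdim (kdimI I) (n - r) (expKPos I) : ℤ)
          - edimN (n - r + kdimI I) (expKPos I) := by
  have hed : edim I = edimN (n - r + r) (Iraw I) := by
    rw [Nat.sub_add_cancel hrn]
    rfl
  rw [hed]
  exact sh_main (q := n - r) (d := kdimI I) (Iraw I) (fun l => (sh_sub_facts (I l) (hI l)).1)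
    (fun l => (sh_sub_facts (I l) (hI l)).2.1) (fun l => (sh_sub_facts (I l) (hI l)).2.2)
    rfl hk1 (hk2.trans (Nat.sub_le _ _)) (expKPos I) (by omega) (fun _ _ => rfl)
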